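/- Let t : Ω → Σ be a Kolmogorov compression model and Q a probability measure on Ω, and let E* be defined by E*(ω) = |t^{-1}(t(ω))| · Q({ω}) / Q(t^{-1}(t(ω))) for ω with Q(t^{-1}(t(ω))) > 0 (and E*(ω) = 1 otherwise). Then the e-power of E* under Q equals ∑_{σ : Q(t^{-1}(σ))>0} Q(t^{-1}(σ)) ln |t^{-1}(σ)| + H(t_*Q) − H(Q), where t_*Q is the push-forward of Q by t and H denotes Shannon entropy (natural logarithm). -/

import Mathlib

open Finset

/-- A probability measure on a finite type, given by its mass function. -/
def IsProbability {Ω : Type*} [Fintype Ω] (Q : Ω → ℝ) : Prop :=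
  (∀ ω, 0 ≤ Q ω) ∧ ∑ ω : Ω, Q ω = 1

/-- The e-power of `E` under `Q`: `∑_{ω : Q({ω}) > 0} Q({ω}) ln E(ω)`. -/
noncomputable def ePower {Ω : Type*} [Fintype Ω] (Q : Ω → ℝ) (E : Ω → ℝ) : ℝ :=
  ∑ ω ∈ Finset.univ.filter fun ω => 0 < Q ω, Q ω * Real.log (E ω)

/-- Shannon entropy (natural logarithm) of a mass function on a finite type;
the convention `0 ln 0 = 0` holds since `Real.log 0 = 0`. -/
noncomputable def entropy {α : Type*} [Fintype α] (P : α → ℝ) : ℝ :=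
  -∑ x : α, P x * Real.log (P x)

/-- The likelihood-ratio e-variable `E*`. -/
noncomputable def optimalE {Ω S : Type*} [Fintype Ω] [DecidableEq S] (t : Ω → S)
    (Q : Ω → ℝ) (ω : Ω) : ℝ :=
  if 0 < ∑ ω' ∈ Finset.univ.filter fun ω' => t ω' = t ω, Q ω' then
    ((Finset.univ.filter fun ω' => t ω' = t ω).card : ℝ) * Q ω /
      (∑ ω' ∈ Finset.univ.filter fun ω' => t ω' = t ω, Q ω')
  else 1

/-- The push-forward of `Q` by `t`, as a mass function on `S`. -/
def pushforward {Ω S : Type*} [Fintype Ω] [DecidableEq S] (t : Ω → S) (Q : Ω → ℝ)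
    (σ : S) : ℝ :=
  ∑ ω ∈ Finset.univ.filter fun ω => t ω = σ, Q ω

theorem sum_pushforward_mul {Ω S : Type*} [Fintype Ω] [Fintype S]
    [DecidableEq S] (t : Ω → S) (Q : Ω → ℝ) (f : S → ℝ) :
    ∑ σ : S, pushforward t Q σ * f σ = ∑ ω : Ω, Q ω * f (t ω) := by
  rw [← Finset.sum_fiberwise (s := Finset.univ) (g := t)]
  refine Finset.sum_congr rfl fun σ _ => ?_
  rw [pushforward, Finset.sum_mul]
  refine Finset.sum_congr rfl fun ω hω => ?_
  rw [(Finset.mem_filter.mp hω).2]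

theorem ePower_optimalE_eq {Ω S : Type*} [Fintype Ω] [Nonempty Ω] [Fintype S]
    [DecidableEq S] (t : Ω → S) (Q : Ω → ℝ) (hQ : IsProbability Q) :
    ePower Q (optimalE t Q) =
      (∑ σ ∈ Finset.univ.filter fun σ : S => 0 < pushforward t Q σ,
        pushforward t Q σ *
          Real.log ((Finset.univ.filter fun ω => t ω = σ).card : ℝ))
      + entropy (pushforward t Q) - entropy Q := by
  obtain ⟨h0, -⟩ := hQ
  have hp : ∀ σ, 0 ≤ pushforward t Q σ := fun σ => Finset.sum_nonneg fun ω _ => h0 ω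
  have hfilter : (∑ σ ∈ Finset.univ.filter fun σ : S => 0 < pushforward t Q σ,
        pushforward t Q σ *
          Real.log ((Finset.univ.filter fun ω => t ω = σ).card : ℝ)) =
      ∑ σ : S, pushforward t Q σ *
          Real.log ((Finset.univ.filter fun ω => t ω = σ).card : ℝ) := by
    refine Finset.sum_filter_of_ne fun σ _ hne => ?_
    exact lt_of_le_of_ne (hp σ) fun h => hne (by rw [← h, zero_mul])
  have hE : ePower Q (optimalE t Q) = ∑ ω : Ω, Q ω * Real.log (optimalE t Q ω) := by
    refine Finset.sum_filter_of_ne fun ω _ hne => ?_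
    exact lt_of_le_of_ne (h0 ω) fun h => hne (by rw [← h, zero_mul])
  rw [hfilter, hE, entropy, entropy,
    sum_pushforward_mul t Q fun σ =>
      Real.log ((Finset.univ.filter fun ω => t ω = σ).card : ℝ),
    sum_pushforward_mul t Q fun σ => Real.log (pushforward t Q σ),
    sub_neg_eq_add, ← Finset.sum_neg_distrib, ← Finset.sum_add_distrib,
    ← Finset.sum_add_distrib]
  refine Finset.sum_congr rfl fun ω _ => ?_
  rcases (h0 ω).eq_or_lt with h | h
  · simp [← h]
  · have hmem : ω ∈ Finset.univ.filter fun ω' => t ω' = t ω := by simp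
    have hpos : 0 < pushforward t Q (t ω) :=
      lt_of_lt_of_le h (Finset.single_le_sum (f := Q) (fun i _ => h0 i) hmem)
    have hc : ((Finset.univ.filter fun ω' => t ω' = t ω).card : ℝ) ≠ 0 := by
      exact_mod_cast (Finset.card_pos.mpr ⟨ω, hmem⟩).ne'
    have hopt : optimalE t Q ω = ((Finset.univ.filter fun ω' => t ω' = t ω).card : ℝ) * Q ω /
        pushforward t Q (t ω) := if_pos hpos
    rw [hopt, Real.log_div (mul_ne_zero hc h.ne') hpos.ne', Real.log_mul hc h.ne']
    ring
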